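/- For every n ≥ 6, every convex n-gon has an ear (a triangle formed by three consecutive vertices) whose area is at most 1/n times the area of the n-gon; equivalently, g_n = 1 − f_n(n−1) ≤ 1/n, i.e., every convex n-gon contains an (n−1)-gon on its vertices whose area is at least (n−1)/n times the area of the n-gon. -/

import Mathlib

open MeasureTheory

/-- The area of a planar point set: the Lebesgue measure of its convex hull. -/
noncomputable def area (S : Set (ℝ × ℝ)) : ℝ :=
  (volume (convexHull ℝ S)).toReal

/-- Points in strictly convex position, affinely spanning the plane. -/
def StrictConvexPos {n : ℕ} (p : Fin n → ℝ × ℝ) : Prop :=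
  (∀ i : Fin n, p i ∉ convexHull ℝ (p '' {j | j ≠ i})) ∧
    affineSpan ℝ (Set.range p) = ⊤

/-- The cross product (twice the signed area) of the triangle `a b c`. -/
def Cross (a b c : ℝ × ℝ) : ℝ :=
  (b.1 - a.1) * (c.2 - a.2) - (b.2 - a.2) * (c.1 - a.1)

/-- The vertices `p 0, p 1, …, p (n-1)` are labeled in cyclic order around their
convex hull: all remaining vertices lie strictly on one and the same side of
each directed edge `p i → p (i+1)`. -/
def ConvexCyclic {n : ℕ} [NeZero n] (p : Fin n → ℝ × ℝ) : Prop :=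
  (∀ i j : Fin n, j ≠ i → j ≠ i + 1 → 0 < Cross (p i) (p (i + 1)) (p j)) ∨
  (∀ i j : Fin n, j ≠ i → j ≠ i + 1 → Cross (p i) (p (i + 1)) (p j) < 0)

/-- The cross product of the edge vectors `b - a` and `d - c`. -/
def edgeCross (a b c d : ℝ × ℝ) : ℝ :=
  (b.1 - a.1) * (d.2 - c.2) - (b.2 - a.2) * (d.1 - c.1)

/-- The first `N` points of `p` are the vertices of a convex polygon, counterclockwise. -/
def ConvexChain (N : ℕ) (p : ℕ → ℝ × ℝ) : Prop :=
  ∀ i j k, i < j → j < k → k < N → 0 < Cross (p i) (p j) (p k)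

/-- The area of the standard triangle. -/
noncomputable def unitTriangleArea : ℝ :=
  area {((0 : ℝ), (0 : ℝ)), (1, 0), (0, 1)}

theorem area_nonneg (S : Set (ℝ × ℝ)) : 0 ≤ area S := ENNReal.toReal_nonneg

theorem volume_convexHull_ne_top {S : Set (ℝ × ℝ)} (hS : S.Finite) :
    volume (convexHull ℝ S) ≠ ⊤ :=
  (hS.isCompact_convexHull ℝ).measure_lt_top.ne

theorem area_image_linearMap (L : (ℝ × ℝ) →ₗ[ℝ] ℝ × ℝ) (S : Set (ℝ × ℝ)) :
    area (L '' S) = |LinearMap.det L| * area S := by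
  unfold area
  rw [← L.image_convexHull, Measure.addHaar_image_linearMap, ENNReal.toReal_mul,
    ENNReal.toReal_ofReal (abs_nonneg _)]

theorem area_vadd (a : ℝ × ℝ) (S : Set (ℝ × ℝ)) : area ((fun x => a + x) '' S) = area S := by
  have h : convexHull ℝ ((fun x => a + x) '' S) = (fun x => a + x) '' convexHull ℝ S :=
    convexHull_vadd a S
  unfold area
  rw [h, Set.image_add_left, measure_preimage_add]

theorem area_swap (S : Set (ℝ × ℝ)) : area (Prod.swap '' S) = area S := by
  have hL := area_image_linearMap (LinearEquiv.prodComm ℝ ℝ ℝ : (ℝ × ℝ) →ₗ[ℝ] ℝ × ℝ)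
  have hinv (T : Set (ℝ × ℝ)) :
      (LinearEquiv.prodComm ℝ ℝ ℝ : (ℝ × ℝ) →ₗ[ℝ] ℝ × ℝ) '' T = Prod.swap '' T := rfl
  have hdet : |LinearMap.det (LinearEquiv.prodComm ℝ ℝ ℝ : (ℝ × ℝ) →ₗ[ℝ] ℝ × ℝ)| = 1 := by
    have h : LinearMap.det (LinearEquiv.prodComm ℝ ℝ ℝ : (ℝ × ℝ) →ₗ[ℝ] ℝ × ℝ) *
        LinearMap.det (LinearEquiv.prodComm ℝ ℝ ℝ : (ℝ × ℝ) →ₗ[ℝ] ℝ × ℝ) = 1 := by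
      rw [← LinearMap.det_comp]
      have : (LinearEquiv.prodComm ℝ ℝ ℝ : (ℝ × ℝ) →ₗ[ℝ] ℝ × ℝ) ∘ₗ
          (LinearEquiv.prodComm ℝ ℝ ℝ : (ℝ × ℝ) →ₗ[ℝ] ℝ × ℝ) = LinearMap.id := by
        ext <;> rfl
      rw [this, LinearMap.det_id]
    rcases mul_self_eq_one_iff.mp h with h | h <;> rw [h] <;> norm_num
  rw [← hinv, hL, hdet, one_mul]

theorem area_triangle (a b c : ℝ × ℝ) :
    area {a, b, c} = |Cross a b c| * unitTriangleArea := by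
  let M : Matrix (Fin 2) (Fin 2) ℝ := !![b.1 - a.1, c.1 - a.1; b.2 - a.2, c.2 - a.2]
  let L := Matrix.toLin (Module.Basis.finTwoProd ℝ) (Module.Basis.finTwoProd ℝ) M
  have hL (x y : ℝ) :
      L (x, y) = ((b.1 - a.1) * x + (c.1 - a.1) * y, (b.2 - a.2) * x + (c.2 - a.2) * y) :=
    Matrix.toLin_finTwoProd_apply _ _ _ _ _
  have hdet : LinearMap.det L = Cross a b c := by
    rw [LinearMap.det_toLin, Matrix.det_fin_two]
    simp [M, Cross]
    ring
  have himg : ({a, b, c} : Set (ℝ × ℝ)) =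
      (fun x => a + x) '' (L '' {((0 : ℝ), (0 : ℝ)), (1, 0), (0, 1)}) := by
    simp [Set.image_insert_eq, hL, Prod.add_def]
  rw [himg, area_vadd, area_image_linearMap, hdet]
  rfl

theorem cross_combo (a b x y : ℝ × ℝ) {s t : ℝ} (h : s + t = 1) :
    Cross a b (s • x + t • y) = s * Cross a b x + t * Cross a b y := by
  obtain rfl : s = 1 - t := by linarith
  simp only [Cross, Prod.fst_add, Prod.snd_add, Prod.smul_fst, Prod.smul_snd, smul_eq_mul]
  ring

theorem cross_nonneg_of_mem_convexHull {a b : ℝ × ℝ} {S : Set (ℝ × ℝ)}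
    (h : ∀ x ∈ S, 0 ≤ Cross a b x) : ∀ x ∈ convexHull ℝ S, 0 ≤ Cross a b x := by
  refine convexHull_min (t := {x | 0 ≤ Cross a b x}) h ?_
  intro x hx y hy s t hs ht hst
  simp only [Set.mem_ofPred_eq] at *
  rw [cross_combo a b x y hst]
  positivity

theorem cross_nonpos_of_mem_convexHull {a b : ℝ × ℝ} {S : Set (ℝ × ℝ)}
    (h : ∀ x ∈ S, Cross a b x ≤ 0) : ∀ x ∈ convexHull ℝ S, Cross a b x ≤ 0 := by
  have hswap (x : ℝ × ℝ) : Cross b a x = -Cross a b x := by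
    simp only [Cross]
    ring
  intro x hx
  have := cross_nonneg_of_mem_convexHull (a := b) (b := a) (S := S)
    (fun y hy => by rw [hswap]; linarith [h y hy]) x hx
  rw [hswap] at this
  linarith

theorem volume_line_eq_zero {a b c : ℝ × ℝ} (hc : Cross a b c ≠ 0) :
    volume {x | Cross a b x = 0} = 0 := by
  let f : (ℝ × ℝ) →ₗ[ℝ] ℝ :=
    (b.1 - a.1) • LinearMap.snd ℝ ℝ ℝ - (b.2 - a.2) • LinearMap.fst ℝ ℝ ℝ
  have hf (x : ℝ × ℝ) : f (x - a) = Cross a b x := by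
    simp [f, Cross]
  have hset : {x | Cross a b x = 0} = (AffineSubspace.mk' a (LinearMap.ker f) : Set (ℝ × ℝ)) := by
    ext x
    simp only [Set.mem_ofPred_eq, SetLike.mem_coe, AffineSubspace.mem_mk', vsub_eq_sub,
      LinearMap.mem_ker, hf]
  rw [hset]
  refine Measure.addHaar_affineSubspace _ _ fun htop => hc ?_
  have : c ∈ AffineSubspace.mk' a (LinearMap.ker f) := htop ▸ AffineSubspace.mem_top _ _ _
  rwa [AffineSubspace.mem_mk', vsub_eq_sub, LinearMap.mem_ker, hf] at this

/-- Areas of point sets separated by a line add up to at most the area of any larger set. -/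
theorem area_add_le {S T U : Set (ℝ × ℝ)} {a b c : ℝ × ℝ} (hU : U.Finite) (hSU : S ⊆ U)
    (hTU : T ⊆ U) (hc : Cross a b c ≠ 0) (hS : ∀ x ∈ S, 0 ≤ Cross a b x)
    (hT : ∀ x ∈ T, Cross a b x ≤ 0) : area S + area T ≤ area U := by
  have hSf := hU.subset hSU
  have hTf := hU.subset hTU
  have hdisj : AEDisjoint volume (convexHull ℝ S) (convexHull ℝ T) := by
    refine measure_mono_null (fun x hx => ?_) (volume_line_eq_zero hc)
    exact le_antisymm (cross_nonpos_of_mem_convexHull hT x hx.2)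
      (cross_nonneg_of_mem_convexHull hS x hx.1)
  unfold area
  rw [← ENNReal.toReal_add (volume_convexHull_ne_top hSf) (volume_convexHull_ne_top hTf),
    ← measure_union₀ (hTf.isCompact_convexHull ℝ).measurableSet.nullMeasurableSet hdisj]
  exact ENNReal.toReal_mono (volume_convexHull_ne_top hU)
    (measure_mono (Set.union_subset (convexHull_mono hSU) (convexHull_mono hTU)))

theorem cross_rotate (a b c : ℝ × ℝ) : Cross b c a = Cross a b c := by
  simp only [Cross]
  ring

theorem cross_swap_right (a b c : ℝ × ℝ) : Cross a c b = -Cross a b c := by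
  simp only [Cross]
  ring

theorem cross_self_left (a b : ℝ × ℝ) : Cross a b a = 0 := by
  simp [Cross]

theorem cross_self_right (a b : ℝ × ℝ) : Cross a b b = 0 := by
  simp only [Cross]
  ring

/-- Cutting off the middle vertex of three consecutive ones. -/
theorem ConvexChain.area_add_le_of_outside {N : ℕ} {p : ℕ → ℝ × ℝ} (hp : ConvexChain N p)
    {I J : Set ℕ} (hJ : J ⊆ Set.Iio N) (hI : I ⊆ J) {a b c : ℕ} (ha : a ∈ J) (hb : b ∈ J)
    (hc : c ∈ J) (hab : a < b) (hbc : b < c) (h : ∀ i ∈ I, i ≤ a ∨ c ≤ i) :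
    area (p '' I) + Cross (p a) (p b) (p c) * unitTriangleArea ≤ area (p '' J) := by
  have hpos := hp a b c hab hbc (hJ hc)
  rw [← abs_of_pos hpos, ← area_triangle]
  have hneg : Cross (p a) (p c) (p b) < 0 := by rw [cross_swap_right]; linarith
  refine area_add_le (a := p a) (b := p c) (c := p b) (((Set.finite_Iio N).subset hJ).image p)
    (Set.image_mono hI) ?_ hneg.ne ?_ ?_
  · rintro x (rfl | rfl | rfl)
    exacts [⟨a, ha, rfl⟩, ⟨b, hb, rfl⟩, ⟨c, hc, rfl⟩]
  · rintro _ ⟨i, hi, rfl⟩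
    rcases h i hi with h | h <;> rcases h.eq_or_lt with rfl | h
    · rw [cross_self_left]
    · rw [cross_rotate]; exact (hp _ _ _ h (hab.trans hbc) (hJ hc)).le
    · rw [cross_self_right]
    · exact (hp _ _ _ (hab.trans hbc) h (hJ (hI hi))).le
  · rintro x (rfl | rfl | rfl)
    exacts [(cross_self_left _ _).le, hneg.le, (cross_self_right _ _).le]

/-- Cutting off the last vertex. -/
theorem ConvexChain.area_add_le_of_between {N : ℕ} {p : ℕ → ℝ × ℝ} (hp : ConvexChain N p)
    {I J : Set ℕ} (hJ : J ⊆ Set.Iio N) (hI : I ⊆ J) {a b c : ℕ} (ha : a ∈ J) (hb : b ∈ J)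
    (hc : c ∈ J) (hab : a < b) (hbc : b < c) (h : ∀ i ∈ I, a ≤ i ∧ i ≤ b) :
    area (p '' I) + Cross (p b) (p c) (p a) * unitTriangleArea ≤ area (p '' J) := by
  have hpos := hp a b c hab hbc (hJ hc)
  rw [cross_rotate, ← abs_of_pos hpos, ← area_triangle]
  have hneg : Cross (p b) (p a) (p c) < 0 := by rw [cross_swap_right, cross_rotate]; linarith
  refine area_add_le (a := p b) (b := p a) (c := p c) (((Set.finite_Iio N).subset hJ).image p)
    (Set.image_mono hI) ?_ hneg.ne ?_ ?_
  · rintro x (rfl | rfl | rfl)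
    exacts [⟨a, ha, rfl⟩, ⟨b, hb, rfl⟩, ⟨c, hc, rfl⟩]
  · rintro _ ⟨i, hi, rfl⟩
    obtain ⟨h₁, h₂⟩ := h i hi
    rcases h₁.eq_or_lt with rfl | h₁
    · rw [cross_self_right]
    rcases h₂.eq_or_lt with rfl | h₂
    · rw [cross_self_left]
    rw [← cross_rotate]
    exact (hp _ _ _ h₁ h₂ (hJ hb)).le
  · rintro x (rfl | rfl | rfl)
    exacts [(cross_self_right _ _).le, (cross_self_left _ _).le, hneg.le]

/-- A linear functional cannot separate one diagonal of a convex quadrilateral from the other. -/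
theorem not_separated_diagonals {a b c d : ℝ × ℝ} (habc : 0 < Cross a b c)
    (habd : 0 < Cross a b d) (hacd : 0 < Cross a c d) (hbcd : 0 < Cross b c d) (s t : ℝ)
    (hab : s * a.1 + t * a.2 < s * b.1 + t * b.2) (had : s * a.1 + t * a.2 < s * d.1 + t * d.2)
    (hcb : s * c.1 + t * c.2 ≤ s * b.1 + t * b.2)
    (hcd : s * c.1 + t * c.2 ≤ s * d.1 + t * d.2) : False := by
  have key : Cross b c d * (s * a.1 + t * a.2) + Cross a b d * (s * c.1 + t * c.2) =
      Cross a c d * (s * b.1 + t * b.2) + Cross a b c * (s * d.1 + t * d.2) := by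
    simp only [Cross]
    ring
  have total : Cross b c d + Cross a b d = Cross a c d + Cross a b c := by
    simp only [Cross]
    ring
  generalize s * a.1 + t * a.2 = α at *
  generalize s * b.1 + t * b.2 = β at *
  generalize s * c.1 + t * c.2 = γ at *
  generalize s * d.1 + t * d.2 = δ at *
  generalize Cross b c d = A at *
  generalize Cross a c d = B at *
  generalize Cross a b d = C at *
  generalize Cross a b c = D at *
  rcases le_or_gt α γ with h | h
  · have h₁ : A * α ≤ A * γ := mul_le_mul_of_nonneg_left h hbcd.le
    have h₂ : B * γ ≤ B * β := mul_le_mul_of_nonneg_left hcb hacd.le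
    have h₃ : D * γ ≤ D * δ := mul_le_mul_of_nonneg_left hcd habc.le
    have h₄ : A * γ + C * γ = B * γ + D * γ := by rw [← add_mul, total, add_mul]
    have h₅ : A * α = A * γ := by linarith
    have h₆ : B * γ = B * β := by linarith
    have h₇ := mul_left_cancel₀ hbcd.ne' h₅
    have h₈ := mul_left_cancel₀ hacd.ne' h₆
    linarith
  · have h₁ : C * γ < C * α := mul_lt_mul_of_pos_left h habd
    have h₂ : B * α < B * β := mul_lt_mul_of_pos_left hab hacd
    have h₃ : D * α < D * δ := mul_lt_mul_of_pos_left had habc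
    have h₄ : A * α + C * α = B * α + D * α := by rw [← add_mul, total, add_mul]
    linarith

theorem ConvexChain.not_separated {N : ℕ} {p : ℕ → ℝ × ℝ} (hp : ConvexChain N p)
    {a b c d : ℕ} (hab : a < b) (hbc : b < c) (hcd : c < d) (hd : d < N) (s t : ℝ)
    (h₁ : s * (p a).1 + t * (p a).2 < s * (p b).1 + t * (p b).2)
    (h₂ : s * (p a).1 + t * (p a).2 < s * (p d).1 + t * (p d).2)
    (h₃ : s * (p c).1 + t * (p c).2 ≤ s * (p b).1 + t * (p b).2)
    (h₄ : s * (p c).1 + t * (p c).2 ≤ s * (p d).1 + t * (p d).2) : False :=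
  not_separated_diagonals (hp _ _ _ hab hbc (hcd.trans hd)) (hp _ _ _ hab (hbc.trans hcd) hd)
    (hp _ _ _ (hab.trans hbc) hcd hd) (hp _ _ _ hbc hcd hd) s t h₁ h₂ h₃ h₄

/-- If two edges turn by less than `π`, so do an intermediate edge and the last one. -/
theorem ConvexChain.edgeCross_pos_right {N : ℕ} {p : ℕ → ℝ × ℝ} (hp : ConvexChain N p)
    {u u' v v' w w' : ℕ} (hu : u < u') (huv : u' ≤ v) (hv : v < v') (hvw : v' ≤ w) (hw : w < w')
    (hN : w' < N) (h : 0 < edgeCross (p u) (p u') (p w) (p w')) :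
    0 < edgeCross (p v) (p v') (p w) (p w') := by
  by_contra! hcon
  have max_w (i : ℕ) (hi : i < w) : 0 < Cross (p i) (p w) (p w') := hp _ _ _ hi hw hN
  have hmu := max_w u (by omega)
  have hmu' := max_w u' (by omega)
  have hmv := max_w v (by omega)
  have hmv' : 0 ≤ Cross (p v') (p w) (p w') := by
    rcases hvw.eq_or_lt with rfl | hlt
    · simp [Cross]
    · exact (max_w v' hlt).le
  simp only [edgeCross, Cross] at h hcon hmu hmu' hmv hmv'
  rcases le_or_gt (edgeCross (p v') (p u') (p w) (p w')) 0 with h' | h' <;>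
    simp only [edgeCross] at h'
  · exact hp.not_separated (a := u) (b := v) (c := v') (d := w') (by omega) (by omega) (by omega)
      hN ((p w').2 - (p w).2) (-((p w').1 - (p w).1)) (by linarith) (by linarith) (by linarith)
      (by linarith)
  · exact hp.not_separated (a := u) (b := u') (c := v') (d := w') (by omega) (by omega) (by omega)
      hN ((p w').2 - (p w).2) (-((p w').1 - (p w).1)) (by linarith) (by linarith) (by linarith)
      (by linarith)

/-- If two edges turn by less than `π`, so do the first one and an intermediate edge. -/
theorem ConvexChain.edgeCross_pos_left {N : ℕ} {p : ℕ → ℝ × ℝ} (hp : ConvexChain N p)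
    {u u' v v' w w' : ℕ} (hu : u < u') (huv : u' ≤ v) (hv : v < v') (hvw : v' ≤ w) (hw : w < w')
    (hN : w' < N) (h : 0 < edgeCross (p u) (p u') (p w) (p w')) :
    0 < edgeCross (p u) (p u') (p v) (p v') := by
  by_contra! hcon
  have min_u (i : ℕ) (hi : u' < i) (hi' : i < N) : 0 < Cross (p u) (p u') (p i) :=
    hp _ _ _ hu hi hi'
  have hmw := min_u w (by omega) (by omega)
  have hmw' := min_u w' (by omega) (by omega)
  have hmv' := min_u v' (by omega) (by omega)
  have hmv : 0 ≤ Cross (p u) (p u') (p v) := by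
    rcases huv.eq_or_lt with rfl | hlt
    · rw [cross_self_right]
    · exact (min_u v hlt (by omega)).le
  simp only [edgeCross, Cross] at h hcon hmw hmw' hmv hmv'
  rcases le_or_gt 0 (edgeCross (p u) (p u') (p v) (p w)) with h' | h' <;>
    simp only [edgeCross] at h'
  · exact hp.not_separated (a := u) (b := v) (c := v') (d := w') (by omega) (by omega) (by omega)
      hN (-((p u').2 - (p u).2)) ((p u').1 - (p u).1) (by linarith) (by linarith) (by linarith)
      (by linarith)
  · exact hp.not_separated (a := u) (b := v) (c := w) (d := w') (by omega) (by omega) (by omega)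
      hN (-((p u').2 - (p u).2)) ((p u').1 - (p u).1) (by linarith) (by linarith) (by linarith)
      (by linarith)

/-- If the first and last edges turn by less than `π`, so does any pair of edges in between. -/
theorem ConvexChain.edgeCross_pos {N : ℕ} {p : ℕ → ℝ × ℝ} (hp : ConvexChain N p) (hN : 3 ≤ N)
    (h : 0 < edgeCross (p 0) (p 1) (p (N - 2)) (p (N - 1))) {i j : ℕ} (hij : i < j)
    (hj : j + 1 < N) : 0 < edgeCross (p i) (p (i + 1)) (p j) (p (j + 1)) := by
  have hi : 0 < edgeCross (p i) (p (i + 1)) (p (N - 2)) (p (N - 1)) := by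
    rcases Nat.eq_zero_or_pos i with rfl | hi
    · exact h
    · exact hp.edgeCross_pos_right (by omega) hi (by omega) (by omega) (by omega) (by omega) h
  rcases (show j ≤ N - 2 by omega).eq_or_lt with rfl | hlt
  · rwa [show N - 2 + 1 = N - 1 by omega]
  · exact hp.edgeCross_pos_left (by omega) hij (by omega) (by omega) (by omega) (by omega) hi

theorem ConvexChain.rotate {N : ℕ} {p : ℕ → ℝ × ℝ} (hp : ConvexChain (N + 1) p) :
    ConvexChain (N + 1) (fun k => if k = 0 then p N else p (k - 1)) := by
  intro i j k hij hjk hk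
  simp only [show j ≠ 0 by omega, show k ≠ 0 by omega, if_false]
  split_ifs with hi
  · rw [← cross_rotate]
    exact hp _ _ _ (by omega) (by omega) (by omega)
  · exact hp _ _ _ (by omega) (by omega) (by omega)

/-- The triangle spanned by alternate vertices of a convex hexagon has at least three times the
area of the smallest ear; this is the underlying inequality between barycentric coordinates. -/
theorem three_mul_le_of_hexagon {m T h₁ h₂ h₃ x₁ x₂ x₃ y₁ y₂ y₃ : ℝ} (hT : 0 < T)
    (hh₁ : m ≤ h₁) (hh₂ : m ≤ h₂) (hh₃ : m ≤ h₃) (hx₁ : 0 < x₁) (hx₂ : 0 < x₂) (hx₃ : 0 < x₃)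
    (hy₁ : 0 < y₁) (hy₂ : 0 < y₂) (hy₃ : 0 < y₃) (h₁s : x₁ + y₁ = T + h₁)
    (h₂s : x₂ + y₂ = T + h₂) (h₃s : x₃ + y₃ = T + h₃) (h₁₂ : T * m + h₁ * h₂ ≤ y₁ * x₂)
    (h₂₃ : T * m + h₂ * h₃ ≤ y₂ * x₃) (h₃₁ : T * m + h₃ * h₁ ≤ y₃ * x₁) : 3 * m ≤ T := by
  by_contra! hlt
  have pair {a b : ℝ} (ha : m ≤ a) (hb : m ≤ b) : (T + a) * (T + b) < 4 * (T * m + a * b) := by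
    nlinarith [mul_nonneg (show 0 ≤ a - T / 3 by linarith) (show 0 ≤ b - T / 3 by linarith),
      mul_pos hT (show 0 < m - T / 3 by linarith)]
  have amgm {x y a : ℝ} (h : x + y = T + a) : 4 * (x * y) ≤ (T + a) ^ 2 := by
    rw [← h]
    nlinarith [sq_nonneg (x - y)]
  have hm : 0 < m := by linarith
  have p₁ : 0 < T + h₁ := by linarith
  have p₂ : 0 < T + h₂ := by linarith
  have p₃ : 0 < T + h₃ := by linarith
  have l₁ : (T + h₁) * (T + h₂) < 4 * (y₁ * x₂) := (pair hh₁ hh₂).trans_le (by linarith)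
  have l₂ : (T + h₂) * (T + h₃) < 4 * (y₂ * x₃) := (pair hh₂ hh₃).trans_le (by linarith)
  have l₃ : (T + h₃) * (T + h₁) < 4 * (y₃ * x₁) := (pair hh₃ hh₁).trans_le (by linarith)
  have lower := mul_lt_mul'' (mul_lt_mul'' l₁ l₂ (by positivity) (by positivity)) l₃
    (by positivity) (by positivity)
  have upper := mul_le_mul (mul_le_mul (amgm h₁s) (amgm h₂s) (by positivity) (by positivity))
    (amgm h₃s) (by positivity) (by positivity)
  nlinarith [lower, upper]

theorem ConvexChain.hexagon_bound {p : ℕ → ℝ × ℝ} (hp : ConvexChain 6 p) {m : ℝ}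
    (hm : ∀ k, k + 2 < 6 → m ≤ Cross (p k) (p (k + 1)) (p (k + 2)))
    (hm₁ : m ≤ Cross (p 4) (p 5) (p 0)) (hm₂ : m ≤ Cross (p 5) (p 0) (p 1)) :
    6 * m * unitTriangleArea ≤ area (p '' Set.Iio 6) := by
  have e₁ := hm 0 (by norm_num)
  have e₂ := hm 1 (by norm_num)
  have e₃ := hm 2 (by norm_num)
  have e₄ := hm 3 (by norm_num)
  norm_num at e₁ e₂ e₃ e₄
  have hT := hp 0 2 4 (by norm_num) (by norm_num) (by norm_num)
  have key : 3 * m ≤ Cross (p 0) (p 2) (p 4) := by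
    have lift {e : ℝ} (he : m ≤ e) :
        Cross (p 0) (p 2) (p 4) * m ≤ Cross (p 0) (p 2) (p 4) * e :=
      mul_le_mul_of_nonneg_left he hT.le
    refine three_mul_le_of_hexagon (h₁ := Cross (p 0) (p 1) (p 2))
      (h₂ := Cross (p 2) (p 3) (p 4)) (h₃ := Cross (p 4) (p 5) (p 0))
      (x₁ := Cross (p 0) (p 1) (p 4)) (y₁ := Cross (p 1) (p 2) (p 4))
      (x₂ := Cross (p 0) (p 2) (p 3)) (y₂ := Cross (p 0) (p 3) (p 4))
      (x₃ := Cross (p 2) (p 4) (p 5)) (y₃ := Cross (p 0) (p 2) (p 5))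
      hT e₁ e₃ hm₁ ?_ ?_ ?_ ?_ ?_ ?_ ?_ ?_ ?_ ?_ ?_ ?_
    any_goals exact hp _ _ _ (by norm_num) (by norm_num) (by norm_num)
    iterate 3
      · simp only [Cross]
        ring
    · refine (add_le_add_left (lift e₂) _).trans_eq ?_
      simp only [Cross]
      ring
    · refine (add_le_add_left (lift e₄) _).trans_eq ?_
      simp only [Cross]
      ring
    · refine (add_le_add_left (lift hm₂) _).trans_eq ?_
      simp only [Cross]
      ring
  have a₁ := hp.area_add_le_of_outside (I := {0, 2, 4}) (J := {0, 1, 2, 4}) (a := 0) (b := 1)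
    (c := 2) (by intro; simp; omega) (by intro; simp; omega) (by simp) (by simp) (by simp)
    (by norm_num) (by norm_num) (by simp)
  have a₂ := hp.area_add_le_of_outside (I := {0, 1, 2, 4}) (J := {0, 1, 2, 3, 4}) (a := 2) (b := 3)
    (c := 4) (by intro; simp; omega) (by intro; simp; omega) (by simp) (by simp) (by simp)
    (by norm_num) (by norm_num) (by simp)
  have a₃ := hp.area_add_le_of_between (I := {0, 1, 2, 3, 4}) (J := Set.Iio 6) (a := 0) (b := 4)
    (c := 5) (by intro; simp) (by intro; simp; omega) (by simp) (by simp) (by simp)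
    (by norm_num) (by norm_num) (by simp)
  have a₀ : area (p '' {0, 2, 4}) = Cross (p 0) (p 2) (p 4) * unitTriangleArea := by
    rw [← abs_of_pos hT, ← area_triangle]
    simp [Set.image_insert_eq]
  have hκ : 0 ≤ unitTriangleArea := area_nonneg _
  have := mul_le_mul_of_nonneg_right (show 6 * m ≤ Cross (p 0) (p 2) (p 4) +
    Cross (p 0) (p 1) (p 2) + Cross (p 2) (p 3) (p 4) + Cross (p 4) (p 5) (p 0) by linarith) hκ
  linarith

/-- If every ear of a convex `N`-gon has cross product at least `m`, the area is at least `N`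
times that of a triangle with cross product `m`. -/
theorem ConvexChain.mul_le_area {N : ℕ} (hN : 6 ≤ N) : ∀ {p : ℕ → ℝ × ℝ}, ConvexChain N p →
    ∀ {m : ℝ}, (∀ k, k + 2 < N → m ≤ Cross (p k) (p (k + 1)) (p (k + 2))) →
    m ≤ Cross (p (N - 2)) (p (N - 1)) (p 0) → m ≤ Cross (p (N - 1)) (p 0) (p 1) →
    N * m * unitTriangleArea ≤ area (p '' Set.Iio N) := by
  induction N, hN using Nat.le_induction with
  | base =>
    intro p hp m hm hm₁ hm₂
    exact_mod_cast hp.hexagon_bound hm hm₁ hm₂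
  | succ N hN ih =>
    intro p hp m hm hm₁ hm₂
    rw [show N + 1 - 2 = N - 1 by omega, show N + 1 - 1 = N by omega] at hm₁
    rw [show N + 1 - 1 = N by omega] at hm₂
    have hκ : 0 ≤ unitTriangleArea := area_nonneg _
    have finish {A e : ℝ} (hA : N * m * unitTriangleArea ≤ A) (he : m ≤ e)
        (h : A + e * unitTriangleArea ≤ area (p '' Set.Iio (N + 1))) :
        ((N + 1 : ℕ) : ℝ) * m * unitTriangleArea ≤ area (p '' Set.Iio (N + 1)) := by
      have := mul_le_mul_of_nonneg_right he hκ
      push_cast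
      linarith
    by_cases hgood : 0 ≤ edgeCross (p (N - 2)) (p (N - 1)) (p N) (p 0) ∧
        0 ≤ edgeCross (p (N - 1)) (p N) (p 0) (p 1)
    · have hear := hm (N - 2) (by omega)
      rw [show N - 2 + 1 = N - 1 by omega, show N - 2 + 2 = N by omega] at hear
      refine finish (ih (p := p) (fun i j k hi hj hk => hp i j k hi hj (by omega))
        (fun k hk => hm k (by omega)) ?_ ?_) hm₁ (hp.area_add_le_of_between
          (I := Set.Iio N) (J := Set.Iio (N + 1)) (a := 0) (b := N - 1) (c := N) subset_rfl
          (fun x => by simp; omega) (by simp) (by simp) (by simp) (by omega) (by omega)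
          (fun i hi => ⟨by omega, by have := Set.mem_Iio.mp hi; omega⟩))
      · have := hgood.1
        simp only [edgeCross, Cross] at *
        linarith
      · have := hgood.2
        simp only [edgeCross, Cross] at *
        linarith
    · have hturn : 0 ≤ edgeCross (p 1) (p 2) (p 3) (p 4) ∧
          0 ≤ edgeCross (p 2) (p 3) (p 4) (p 5) := by
        rw [not_and_or, not_le, not_le] at hgood
        rcases hgood with h | h
        · have hq := hp.rotate
          have hpos := fun i j => hq.edgeCross_pos (i := i) (j := j) (by omega) (by
            simp only [if_true, show N + 1 - 2 ≠ 0 by omega, show N + 1 - 1 ≠ 0 by omega, if_false,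
              one_ne_zero, show N + 1 - 2 - 1 = N - 2 by omega,
              show N + 1 - 1 - 1 = N - 1 by omega, Nat.sub_self]
            simp only [edgeCross] at *
            linarith)
          exact ⟨by simpa using (hpos 2 4 (by omega) (by omega)).le,
            by simpa using (hpos 3 5 (by omega) (by omega)).le⟩
        · have hpos := fun i j => hp.edgeCross_pos (i := i) (j := j) (by omega) (by
            rw [show N + 1 - 2 = N - 1 by omega, show N + 1 - 1 = N by omega]
            simp only [edgeCross] at *
            linarith)
          exact ⟨(hpos 1 3 (by omega) (by omega)).le, (hpos 2 4 (by omega) (by omega)).le⟩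
      let q : ℕ → ℝ × ℝ := fun k => if k < 3 then p k else p (k + 1)
      have hlt {k : ℕ} (hk : k < 3) : q k = p k := if_pos hk
      have hge {k : ℕ} (hk : 3 ≤ k) : q k = p (k + 1) := if_neg (by omega)
      have hq : ConvexChain N q := by
        intro i j k hij hjk hk
        simp only [q]
        split_ifs <;> first | omega | exact hp _ _ _ (by omega) (by omega) (by omega)
      have himg : q '' Set.Iio N = p '' {k | k < N + 1 ∧ k ≠ 3} := by
        ext x
        constructor
        · rintro ⟨k, hk, rfl⟩
          rw [Set.mem_Iio] at hk
          by_cases h3 : k < 3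
          · exact ⟨k, ⟨by omega, by omega⟩, (hlt h3).symm⟩
          · exact ⟨k + 1, ⟨by omega, by omega⟩, (hge (by omega)).symm⟩
        · rintro ⟨k, ⟨hk, hk'⟩, rfl⟩
          by_cases h3 : k < 3
          · exact ⟨k, Set.mem_Iio.mpr (by omega), hlt h3⟩
          · refine ⟨k - 1, Set.mem_Iio.mpr (by omega), ?_⟩
            rw [hge (by omega), show k - 1 + 1 = k by omega]
      refine finish (ih hq (m := m) ?_ ?_ ?_) (hm 2 (by omega)) ?_
      · intro k hk
        have e₁ := hm 1 (by omega)
        have e₃ := hm 3 (by omega)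
        rcases show k = 0 ∨ k = 1 ∨ k = 2 ∨ 3 ≤ k by omega with rfl | rfl | rfl | h3
        · exact hm 0 (by omega)
        · have := hturn.1
          simp [q, edgeCross, Cross] at *
          linarith
        · have := hturn.2
          simp [q, edgeCross, Cross] at *
          linarith
        · rw [hge h3, hge (by omega), hge (by omega)]
          exact hm (k + 1) (by omega)
      · rw [hge (by omega), hge (by omega), hlt (by omega), show N - 2 + 1 = N - 1 by omega,
          show N - 1 + 1 = N by omega]
        exact hm₁
      · rw [hge (by omega), hlt (by omega), hlt (by omega), show N - 1 + 1 = N by omega]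
        exact hm₂
      · rw [himg]
        exact hp.area_add_le_of_outside (a := 2) (b := 3) (c := 4) subset_rfl
          (fun k hk => hk.1) (Set.mem_Iio.mpr (by omega)) (Set.mem_Iio.mpr (by omega))
          (Set.mem_Iio.mpr (by omega)) (by omega) (by omega)
          (fun i hi => by have := hi.2; omega)

/-- Adding a vertex `b` to a point set enlarges the convex hull at most by the ear at `b`. -/
theorem convexHull_insert_subset {a b c : ℝ × ℝ} {S : Set (ℝ × ℝ)} (ha : a ∈ S) (hc : c ∈ S)
    (hpos : 0 < Cross a b c) (h₁ : ∀ x ∈ S, 0 ≤ Cross a b x) (h₂ : ∀ x ∈ S, 0 ≤ Cross b c x) :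
    convexHull ℝ (insert b S) ⊆ convexHull ℝ {a, b, c} ∪ convexHull ℝ S := by
  intro x hx
  rw [convexHull_insert ⟨a, ha⟩, mem_convexJoin] at hx
  obtain ⟨b', hb', y, hy, s, t, hs, ht, hst, rfl⟩ := hx
  obtain rfl : b = b' := hb'.symm
  obtain rfl : s = 1 - t := by linarith
  obtain ⟨β, hβ⟩ : ∃ β, β = Cross b c y / Cross a b c := ⟨_, rfl⟩
  obtain ⟨γ, hγ⟩ : ∃ γ, γ = Cross a b y / Cross a b c := ⟨_, rfl⟩
  have hβ0 : 0 ≤ β := hβ ▸ div_nonneg (cross_nonneg_of_mem_convexHull h₂ y hy) hpos.le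
  have hγ0 : 0 ≤ γ := hγ ▸ div_nonneg (cross_nonneg_of_mem_convexHull h₁ y hy) hpos.le
  have hyeq : y = (1 - β - γ) • b + β • a + γ • c := by
    rw [hβ, hγ]
    ext <;> simp only [Prod.fst_add, Prod.snd_add, Prod.smul_fst, Prod.smul_snd, smul_eq_mul] <;>
      field_simp <;> simp only [Cross] <;> ring
  rcases le_or_gt (t * (β + γ)) 1 with h | h
  · left
    have hmem {z : ℝ × ℝ} (hz : z ∈ ({a, b, c} : Set (ℝ × ℝ))) :
        z ∈ convexHull ℝ {a, b, c} := subset_convexHull ℝ _ hz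
    have : (1 - t) • b + t • y = (1 - t * (β + γ)) • b + (t * β) • a + (t * γ) • c := by
      rw [hyeq]
      module
    rw [this]
    have hsum := (convex_convexHull ℝ ({a, b, c} : Set (ℝ × ℝ))).sum_mem
      (t := Finset.univ) (w := ![1 - t * (β + γ), t * β, t * γ]) (z := ![b, a, c])
      (by
        intro k _
        fin_cases k
        exacts [sub_nonneg.mpr h, mul_nonneg ht hβ0, mul_nonneg ht hγ0])
      (by
        simp [Fin.sum_univ_three]
        ring)
      (by
        intro k _
        fin_cases k <;> exact hmem (by simp))
    simpa [Fin.sum_univ_three] using hsum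
  · right
    have hσ : 1 < β + γ := by nlinarith
    have hσ0 : 0 < β + γ := by linarith
    have hz : (β / (β + γ)) • a + (γ / (β + γ)) • c ∈ convexHull ℝ S :=
      (convex_convexHull ℝ S) (subset_convexHull ℝ S ha) (subset_convexHull ℝ S hc)
        (by positivity) (by positivity) (by field_simp)
    have hw := (convex_convexHull ℝ S) hz hy
      (a := (1 - t) * (β + γ) / (β + γ - 1)) (b := (t * (β + γ) - 1) / (β + γ - 1))
      (div_nonneg (mul_nonneg hs hσ0.le) (by linarith)) (div_nonneg (by linarith) (by linarith))
      (by have : β + γ - 1 ≠ 0 := by linarith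
          field_simp
          ring)
    convert hw using 1
    have hne : β + γ - 1 ≠ 0 := by linarith
    rw [hyeq]
    ext <;> simp only [Prod.fst_add, Prod.snd_add, Prod.smul_fst, Prod.smul_snd, smul_eq_mul] <;>
      field_simp <;> ring

/-- All triples of vertices of a counterclockwise polygon are counterclockwise. -/
theorem convexChain_of_edges {N : ℕ} {p : ℕ → ℝ × ℝ}
    (h : ∀ i j, i + 1 < N → j < N → j ≠ i → j ≠ i + 1 → 0 < Cross (p i) (p (i + 1)) (p j)) :
    ConvexChain N p := by
  intro i j k hij hjk
  induction k, hjk using Nat.le_induction with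
  | base =>
    intro hk
    rw [← cross_rotate]
    exact h j i hk (by omega) (by omega) (by omega)
  | succ k hjk ih =>
    intro hk
    have h₁ := ih (by omega)
    have h₂ := h k i hk (by omega) (by omega) (by omega)
    have h₃ := h i (k + 1) (by omega) hk (by omega) (by omega)
    have h₄ := h i k (by omega) (by omega) (by omega) (by omega)
    have h₅ : 0 ≤ Cross (p i) (p (i + 1)) (p j) := by
      rcases (show i + 1 ≤ j by omega).eq_or_lt with rfl | hlt
      · rw [cross_self_right]
      · exact (h i j (by omega) (by omega) (by omega) (by omega)).le
    have key : Cross (p i) (p (i + 1)) (p k) * Cross (p i) (p j) (p (k + 1)) =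
        Cross (p i) (p (i + 1)) (p j) * Cross (p k) (p (k + 1)) (p i) +
          Cross (p i) (p (i + 1)) (p (k + 1)) * Cross (p i) (p j) (p k) := by
      simp only [Cross]
      ring
    refine pos_of_mul_pos_right (a := Cross (p i) (p (i + 1)) (p k)) ?_ h₄.le
    rw [key]
    exact add_pos_of_nonneg_of_pos (mul_nonneg h₅ h₂.le) (mul_pos h₃ h₁)

theorem exists_small_ear_of_pos (n : ℕ) [NeZero n] (hn : 6 ≤ n) (p : Fin n → ℝ × ℝ)
    (h : ∀ i j : Fin n, j ≠ i → j ≠ i + 1 → 0 < Cross (p i) (p (i + 1)) (p j)) :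
    ∃ i : Fin n, area {p (i - 1), p i, p (i + 1)} ≤ (1 / (n : ℝ)) * area (Set.range p) ∧
      area (Set.range p) ≤
        area {p (i - 1), p i, p (i + 1)} + area (p '' ↑(Finset.univ.erase i)) := by
  have hsub (i : Fin n) : i - 1 ≠ i ∧ i + 1 ≠ i ∧ i + 1 ≠ i - 1 ∧ i - 1 + 1 = i := by
    have one_ne : (1 : Fin n) ≠ 0 := by
      rw [ne_eq, Fin.ext_iff, Fin.val_one', Fin.val_zero, Nat.mod_eq_of_lt (by omega)]
      omega
    have two_ne : (1 + 1 : Fin n) ≠ 0 := by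
      rw [ne_eq, Fin.ext_iff, Fin.val_add, Fin.val_one', Fin.val_zero,
        Nat.mod_eq_of_lt (show 1 < n by omega), Nat.mod_eq_of_lt (by omega)]
      omega
    refine ⟨by simpa using one_ne, by simpa using one_ne, fun h => two_ne ?_,
      sub_add_cancel i 1⟩
    rw [eq_sub_iff_add_eq, add_assoc] at h
    simpa using h
  have hear (i : Fin n) : 0 < Cross (p (i - 1)) (p i) (p (i + 1)) := by
    have := h (i - 1) (i + 1) (hsub i).2.2.1 (by rw [(hsub i).2.2.2]; exact (hsub i).2.1)
    rwa [(hsub i).2.2.2] at this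
  obtain ⟨i, hi⟩ := Finite.exists_min fun i => Cross (p (i - 1)) (p i) (p (i + 1))
  refine ⟨i, ?_, ?_⟩
  · let q : ℕ → ℝ × ℝ := fun k => p (Fin.ofNat n k)
    have hval {k : ℕ} (hk : k < n) : (Fin.ofNat n k).val = k := Nat.mod_eq_of_lt hk
    have hsucc (k : ℕ) : Fin.ofNat n (k + 1) = Fin.ofNat n k + 1 := by
      ext
      simp [Fin.val_add]
    have hlast : Fin.ofNat n (n - 1) + 1 = Fin.ofNat n 0 := by
      rw [← hsucc, Nat.sub_add_cancel (by omega)]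
      ext
      simp
    have hpred {a b : Fin n} (hab : a + 1 = b) : b - 1 = a := by
      rw [← hab, add_sub_cancel_right]
    have hq : ConvexChain n q := by
      refine convexChain_of_edges fun i j hi hj hji hji' => ?_
      simp only [q, hsucc]
      refine h _ _ (fun he => hji ?_) (fun he => hji' ?_)
      · rw [← hval hj, he, hval (by omega)]
      · rw [← hsucc] at he
        rw [← hval hj, he, hval hi]
    have hmin (a b c : Fin n) (hab : a + 1 = b) (hbc : b + 1 = c) :
        Cross (p (i - 1)) (p i) (p (i + 1)) ≤ Cross (p a) (p b) (p c) := by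
      have := hi b
      rwa [hpred hab, hbc] at this
    have hA := hq.mul_le_area hn (m := Cross (p (i - 1)) (p i) (p (i + 1)))
      (fun k hk => hmin _ _ _ (hsucc _).symm (hsucc _).symm)
      (hmin _ _ _ (by rw [← hsucc]; congr 1; omega) hlast)
      (hmin _ _ _ hlast (hsucc 0).symm)
    have himg : q '' Set.Iio n = Set.range p := by
      ext x
      constructor
      · rintro ⟨k, -, rfl⟩
        exact ⟨_, rfl⟩
      · rintro ⟨j, rfl⟩
        exact ⟨j, j.isLt, congrArg p (Fin.ext (hval j.isLt))⟩
    rw [himg] at hA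
    rw [area_triangle, abs_of_pos (hear i)]
    have : (0 : ℝ) < n := by positivity
    field_simp
    linarith
  · have hfin : (p '' ↑(Finset.univ.erase i)).Finite := Set.toFinite _
    have hrange : Set.range p = insert (p i) (p '' ↑(Finset.univ.erase i)) := by
      rw [← Set.image_insert_eq, ← Finset.coe_insert, Finset.insert_erase (Finset.mem_univ i),
        Finset.coe_univ, Set.image_univ]
    have hedge (k : Fin n) : ∀ x ∈ p '' ↑(Finset.univ.erase i), 0 ≤ Cross (p k) (p (k + 1)) x := by
      rintro _ ⟨j, -, rfl⟩
      by_cases hj : j = k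
      · rw [hj, cross_self_left]
      by_cases hj' : j = k + 1
      · rw [hj', cross_self_right]
      exact (h k j hj hj').le
    have hcover := convexHull_insert_subset (S := p '' ↑(Finset.univ.erase i))
      ⟨i - 1, by simpa using (hsub i).1, rfl⟩ ⟨i + 1, by simpa using (hsub i).2.1, rfl⟩ (hear i)
      (by simpa only [(hsub i).2.2.2] using hedge (i - 1)) (hedge i)
    rw [hrange]
    unfold area
    have htri : volume (convexHull ℝ {p (i - 1), p i, p (i + 1)}) ≠ ⊤ :=
      volume_convexHull_ne_top (Set.toFinite _)
    rw [← ENNReal.toReal_add htri (volume_convexHull_ne_top hfin)]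
    exact ENNReal.toReal_mono (ENNReal.add_ne_top.mpr ⟨htri, volume_convexHull_ne_top hfin⟩)
      ((measure_mono hcover).trans (measure_union_le _ _))

/-- For `n ≥ 6`, every convex `n`-gon has an ear of area at most `1/n` times the
area of the `n`-gon; equivalently, it contains an `(n-1)`-gon on its vertices
whose area is at least `(n-1)/n` times the area of the `n`-gon. -/
theorem ngon_small_ear
    (n : ℕ) [NeZero n] (hn : 6 ≤ n)
    (p : Fin n → ℝ × ℝ) (hp : StrictConvexPos p) (hcyc : ConvexCyclic p) :
    (∃ i : Fin n, area {p (i - 1), p i, p (i + 1)} ≤ (1 / (n : ℝ)) * area (Set.range p)) ∧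
    (∃ s : Finset (Fin n), s.card = n - 1 ∧
      (((n : ℝ) - 1) / n) * area (Set.range p) ≤ area (p '' ↑s)) := by
  have hmain : ∃ i : Fin n,
      area {p (i - 1), p i, p (i + 1)} ≤ (1 / (n : ℝ)) * area (Set.range p) ∧
      area (Set.range p) ≤
        area {p (i - 1), p i, p (i + 1)} + area (p '' ↑(Finset.univ.erase i)) := by
    rcases hcyc with h | h
    · exact exists_small_ear_of_pos n hn p h
    · have := exists_small_ear_of_pos n hn (Prod.swap ∘ p) fun i j hj hj' => by
        have := h i j hj hj'
        simp only [Cross, Function.comp_apply, Prod.fst_swap, Prod.snd_swap] at *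
        linarith
      have htri (a b c : Fin n) : area {(Prod.swap ∘ p) a, (Prod.swap ∘ p) b, (Prod.swap ∘ p) c} =
          area {p a, p b, p c} := by
        rw [← area_swap {p a, p b, p c}]
        simp [Set.image_insert_eq]
      simpa only [htri, Set.range_comp, Set.image_comp, area_swap] using this
  obtain ⟨i, hi, hi'⟩ := hmain
  refine ⟨⟨i, hi⟩, Finset.univ.erase i, by simp, ?_⟩
  have hn0 : (n : ℝ) ≠ 0 := Nat.cast_ne_zero.mpr (NeZero.ne n)
  rw [sub_div, div_self hn0, sub_mul, one_mul]
  linarith
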